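/- Let A be a weakly associative relation algebra and let x, y be atoms of A with x;y ≠ 0. Then rng(x) = dom(y). -/

import Mathlib

universe u

/-- A weakly associative relation algebra: a Boolean algebra equipped with
relative multiplication `comp`, converse `conv`, and identity `one'`
satisfying the WA axioms. -/
structure WA (A : Type*) [BooleanAlgebra A] where
  comp : A → A → A
  conv : A → A
  one' : A
  wassoc : ∀ x : A, comp (comp (x ⊓ one') ⊤) ⊤ = comp (x ⊓ one') ⊤
  rdist : ∀ x y z : A, comp (x ⊔ y) z = comp x z ⊔ comp y z
  comp_one' : ∀ x : A, comp x one' = x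
  conv_conv : ∀ x : A, conv (conv x) = x
  conv_sup : ∀ x y : A, conv (x ⊔ y) = conv x ⊔ conv y
  conv_comp : ∀ x y : A, conv (comp x y) = comp (conv y) (conv x)
  tarski : ∀ x y : A, comp (conv x) (comp x y)ᶜ ≤ yᶜ

/-- `dom(x) = (x;x⌣)·1'`. -/
def Dom {A : Type u} [BooleanAlgebra A] (W : WA A) (x : A) : A :=
  W.comp x (W.conv x) ⊓ W.one'

/-- `rng(x) = (x⌣;x)·1'`. -/
def Rng {A : Type u} [BooleanAlgebra A] (W : WA A) (x : A) : A :=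
  W.comp (W.conv x) x ⊓ W.one'

namespace WA

variable {A : Type u} [BooleanAlgebra A] (W : WA A)

theorem conv_mono {a b : A} (h : a ≤ b) : W.conv a ≤ W.conv b := by
  rw [← sup_eq_right, ← W.conv_sup, sup_eq_right.mpr h]

theorem conv_le_iff {a b : A} : W.conv a ≤ b ↔ a ≤ W.conv b :=
  ⟨fun h => by simpa only [W.conv_conv] using W.conv_mono h,
    fun h => by simpa only [W.conv_conv] using W.conv_mono h⟩

theorem conv_bot : W.conv ⊥ = ⊥ :=
  le_bot_iff.mp (W.conv_le_iff.mpr bot_le)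

theorem disjoint_conv {a b : A} (h : Disjoint a b) : Disjoint (W.conv a) (W.conv b) := by
  refine disjoint_iff_inf_le.mpr ?_
  rw [← W.conv_bot, ← W.conv_le_iff]
  exact disjoint_iff_inf_le.mp h |>.trans' <|
    le_inf (W.conv_le_iff.mpr inf_le_left) (W.conv_le_iff.mpr inf_le_right)

theorem comp_mono_left {a b : A} (c : A) (h : a ≤ b) : W.comp a c ≤ W.comp b c := by
  rw [← sup_eq_right, ← W.rdist, sup_eq_right.mpr h]

theorem comp_mono_right {a b : A} (c : A) (h : a ≤ b) : W.comp c a ≤ W.comp c b := by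
  have := W.conv_mono (W.comp_mono_left (W.conv c) (W.conv_mono h))
  simpa only [W.conv_comp, W.conv_conv] using this

theorem conv_one' : W.conv W.one' = W.one' := by
  have h := W.conv_comp (W.conv W.one') W.one'
  rwa [W.comp_one', W.conv_conv, W.comp_one', eq_comm] at h

theorem one'_comp (a : A) : W.comp W.one' a = a := by
  have h := W.conv_comp (W.conv a) W.one'
  rwa [W.comp_one', W.conv_conv, W.conv_one', eq_comm] at h

theorem disjoint_conv_comp {a b c : A} (h : Disjoint (W.comp a b) c) :
    Disjoint (W.comp (W.conv a) c) b :=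
  le_compl_iff_disjoint_right.mp
    ((W.comp_mono_right _ (le_compl_iff_disjoint_left.mpr h)).trans (W.tarski a b))

theorem disjoint_comp_conv {a b c : A} (h : Disjoint (W.comp a b) c) :
    Disjoint (W.comp c (W.conv b)) a := by
  have h₁ := W.disjoint_conv h
  rw [W.conv_comp] at h₁
  have h₂ := W.disjoint_conv (W.disjoint_conv_comp h₁)
  simpa only [W.conv_comp, W.conv_conv] using h₂

theorem comp_le_right {u : A} (hu : u ≤ W.one') (a : A) : W.comp u a ≤ a :=
  (W.comp_mono_left a hu).trans (W.one'_comp a).le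

theorem comp_le_left {u : A} (hu : u ≤ W.one') (a : A) : W.comp a u ≤ a :=
  (W.comp_mono_right a hu).trans (W.comp_one' a).le

theorem conv_le_self {u : A} (hu : u ≤ W.one') : W.conv u ≤ u := by
  have hu' : W.conv u ≤ W.one' := (W.conv_mono hu).trans W.conv_one'.le
  have hw : W.conv u \ u ≤ W.one' := sdiff_le.trans hu'
  have hwu : W.conv (W.conv u \ u) ≤ u := W.conv_le_iff.mpr sdiff_le
  have h₀ : Disjoint (W.comp (W.conv (W.conv u \ u)) (W.conv u \ u)) W.one' :=
    Disjoint.mono_left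
      (le_inf ((W.comp_le_left hw _).trans hwu) (W.comp_le_right (hwu.trans hu) _))
      (by rw [inf_sdiff_self_right]; exact disjoint_bot_left)
  have h₁ := W.disjoint_conv_comp h₀
  rw [W.conv_conv, W.comp_one', disjoint_self] at h₁
  exact sdiff_eq_bot_iff.mp h₁

theorem le_dom_comp (a : A) : a ≤ W.comp (Dom W a) a := by
  have hv : W.one' \ Dom W a ≤ W.one' := sdiff_le
  have hd : Disjoint (W.comp a (W.conv a)) (W.one' \ Dom W a) := by
    rw [Dom, sdiff_inf_self_right]
    exact disjoint_sdiff_self_right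
  have h := W.disjoint_comp_conv hd
  rw [W.conv_conv] at h
  have h₀ : W.comp (W.one' \ Dom W a) a = ⊥ := h.eq_bot_of_le (W.comp_le_right hv a)
  have hs : Dom W a ⊔ W.one' \ Dom W a = W.one' := sup_sdiff_cancel_right inf_le_right
  calc a = W.comp (Dom W a ⊔ W.one' \ Dom W a) a := by rw [hs, W.one'_comp]
    _ ≤ W.comp (Dom W a) a := by rw [W.rdist, h₀, sup_bot_eq]

theorem comp_top_comp_top {u : A} (hu : u ≤ W.one') :
    W.comp (W.comp u ⊤) ⊤ = W.comp u ⊤ := by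
  simpa only [inf_eq_left.mpr hu] using W.wassoc u

theorem dom_le_of_le_comp_top {a u : A} (hu : u ≤ W.one') (h : a ≤ W.comp u ⊤) :
    Dom W a ≤ u := by
  have hD : Dom W a ≤ W.comp u ⊤ :=
    calc Dom W a ≤ W.comp a (W.conv a) := inf_le_left
      _ ≤ W.comp a ⊤ := W.comp_mono_right a le_top
      _ ≤ W.comp (W.comp u ⊤) ⊤ := W.comp_mono_left ⊤ h
      _ = W.comp u ⊤ := W.comp_top_comp_top hu
  have hu' : W.conv u ≤ W.one' := (W.conv_mono hu).trans W.conv_one'.le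
  have hv : Dom W a \ u ≤ W.one' := sdiff_le.trans inf_le_right
  have h₀ : Disjoint (W.comp (W.conv u) (Dom W a \ u)) ⊤ :=
    Disjoint.mono_left
      (le_inf ((W.comp_le_left hv _).trans (W.conv_le_self hu)) (W.comp_le_right hu' _))
      (by rw [inf_sdiff_self_right]; exact disjoint_bot_left)
  have h₁ := W.disjoint_conv_comp h₀
  rw [W.conv_conv] at h₁
  exact sdiff_eq_bot_iff.mp (h₁.symm.eq_bot_of_le (sdiff_le.trans hD))

theorem dom_conv (a : A) : Dom W (W.conv a) = Rng W a := by
  rw [Dom, Rng, W.conv_conv]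

theorem rng_conv (a : A) : Rng W (W.conv a) = Dom W a := by
  rw [← dom_conv, W.conv_conv]

theorem dom_le_rng {a b : A} (hb : IsAtom b) (hab : W.comp a b ≠ ⊥) : Dom W b ≤ Rng W a := by
  have hR : Rng W a ≤ W.one' := inf_le_right
  refine W.dom_le_of_le_comp_top hR ?_
  have hle : b ≤ W.comp (W.conv a) ⊤ := by
    refine hb.not_disjoint_iff_le.mp fun h => hab ?_
    have h₁ := W.disjoint_conv_comp h.symm
    rw [W.conv_conv] at h₁
    exact disjoint_top.mp h₁
  calc b ≤ W.comp (W.conv a) ⊤ := hle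
    _ ≤ W.comp (W.comp (Rng W a) (W.conv a)) ⊤ :=
      W.comp_mono_left ⊤ (W.dom_conv a ▸ W.le_dom_comp (W.conv a))
    _ ≤ W.comp (W.comp (Rng W a) ⊤) ⊤ :=
      W.comp_mono_left ⊤ (W.comp_mono_right _ le_top)
    _ = W.comp (Rng W a) ⊤ := W.comp_top_comp_top hR

theorem isAtom_conv {a : A} (ha : IsAtom a) : IsAtom (W.conv a) := by
  refine ⟨fun h => ha.1 ?_, fun b hb => ?_⟩
  · rw [← W.conv_conv a, h, W.conv_bot]
  · have hlt : W.conv b < a := by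
      refine lt_of_le_of_ne (W.conv_le_iff.mpr hb.le) fun h => hb.ne ?_
      rw [← h, W.conv_conv]
    rw [← W.conv_conv b, ha.2 _ hlt, W.conv_bot]

end WA

/-- If `x, y` are atoms with `x;y ≠ 0`, then `rng(x) = dom(y)`. -/
theorem stmt_16 {A : Type u} [BooleanAlgebra A] (W : WA A)
    (x y : A) (hx : IsAtom x) (hy : IsAtom y) (hxy : W.comp x y ≠ ⊥) :
    Rng W x = Dom W y := by
  refine le_antisymm ?_ (W.dom_le_rng hy hxy)
  rw [← W.dom_conv x, ← W.rng_conv y]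
  refine W.dom_le_rng (W.isAtom_conv hx) fun h => hxy ?_
  rw [← W.conv_conv (W.comp x y), W.conv_comp, h, W.conv_bot]
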